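/- Global Pareto optimality of the maximal equilibrium: let X* be a pure Nash equilibrium such that for every pure Nash equilibrium X' and every agent i, t_i(X') ≤ t_i(X*). Then X* is Pareto-optimal among all nonnegative collection profiles: there is no nonnegative profile X' with U_i(X') ≥ U_i(X*) for all agents i and U_j(X') > U_j(X*) for some agent j. -/

import Mathlib

open Finset

/-- Agent `i`'s total accessible data under fair exchange. -/
noncomputable def total {n : ℕ} (X : Fin n → ℝ) (i : Fin n) : ℝ :=
  X i + ∑ j ∈ univ.filter (fun j => j ≠ i), min (X i) (X j)

/-- Agent `i`'s utility. -/
noncomputable def U {n : ℕ} (b : Fin n → ℝ → ℝ) (c : Fin n → ℝ)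
    (X : Fin n → ℝ) (i : Fin n) : ℝ :=
  b i (total X i) - c i * X i

/-- `X` is a (nonnegative) pure Nash equilibrium of the fair-exchange game. -/
def IsNE {n : ℕ} (b : Fin n → ℝ → ℝ) (c : Fin n → ℝ) (X : Fin n → ℝ) : Prop :=
  (∀ i, 0 ≤ X i) ∧
    ∀ i, ∀ y, 0 ≤ y → U b c (Function.update X i y) i ≤ U b c X i

lemma conc_comb {h : ℝ → ℝ} (hh : ConcaveOn ℝ (Set.Ici 0) h) {a m e : ℝ} (ha : 0 ≤ a)
    (ham : a ≤ m) (hme : m ≤ e) : (e - m) * h a + (m - a) * h e ≤ (e - a) * h m := by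
  rcases eq_or_lt_of_le (ham.trans hme) with h0 | h0
  · have h1 : m = a := by linarith
    have h2 : e = a := by linarith
    subst h1; subst h2; linarith
  · have hp : 0 < e - a := by linarith
    have w1 : 0 ≤ (e - m) / (e - a) := by apply div_nonneg <;> linarith
    have w2 : 0 ≤ (m - a) / (e - a) := by apply div_nonneg <;> linarith
    have w3 : (e - m) / (e - a) + (m - a) / (e - a) = 1 := by field_simp; ring
    have hae : e ∈ Set.Ici (0 : ℝ) := by simp only [Set.mem_Ici]; linarith
    have haa : a ∈ Set.Ici (0 : ℝ) := ha
    have := hh.2 haa hae w1 w2 w3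
    have e1 : ((e - m) / (e - a)) • a + ((m - a) / (e - a)) • e = m := by
      simp only [smul_eq_mul]; field_simp; ring
    rw [e1] at this
    simp only [smul_eq_mul] at this
    have h3 := mul_le_mul_of_nonneg_left this hp.le
    have e2 : (e - a) * ((e - m) / (e - a) * h a + (m - a) / (e - a) * h e)
      = (e - m) * h a + (m - a) * h e := by field_simp
    linarith

lemma conc_mid {h : ℝ → ℝ} (hh : ConcaveOn ℝ (Set.Ici 0) h) {a m e : ℝ} (ha : 0 ≤ a)
    (ham : a ≤ m) (hme : m ≤ e) (hae : h a ≤ h e) : h a ≤ h m := by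
  rcases eq_or_lt_of_le ham with h0 | h0
  · rw [h0]
  · have := conc_comb hh ha ham hme
    have h1 : (m - a) * h a ≤ (m - a) * h e := mul_le_mul_of_nonneg_left hae (by linarith)
    have h2 : (e - a) * h a ≤ (e - a) * h m := by linarith
    exact le_of_mul_le_mul_left h2 (by linarith)

lemma conc_after {h : ℝ → ℝ} (hh : ConcaveOn ℝ (Set.Ici 0) h) {a m e : ℝ} (ha : 0 ≤ a)
    (ham : a < m) (hme : m ≤ e) (hae : h m ≤ h a) : h e ≤ h m := by
  have := conc_comb hh ha ham.le hme
  have h1 : (e - m) * h m ≤ (e - m) * h a := mul_le_mul_of_nonneg_left hae (by linarith)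
  have h2 : (m - a) * h e ≤ (m - a) * h m := by linarith
  exact le_of_mul_le_mul_left h2 (by linarith)

lemma conc_shift {h : ℝ → ℝ} (hh : ConcaveOn ℝ (Set.Ici 0) h) {s u v : ℝ} (hs : 0 ≤ s)
    (hu : 0 ≤ u) (hv : 0 ≤ v) : h s + h (s + u + v) ≤ h (s + u) + h (s + v) := by
  rcases eq_or_lt_of_le (add_nonneg hu hv) with h0 | h0
  · have h1 : u = 0 := by linarith
    have h2 : v = 0 := by linarith
    subst h1; subst h2; simp
  · have h1 := conc_comb hh (a := s) (m := s + u) (e := s + u + v) hs (by linarith) (by linarith)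
    have h2 := conc_comb hh (a := s) (m := s + v) (e := s + u + v) hs (by linarith) (by linarith)
    have h3 : (u + v) * (h s + h (s + u + v)) ≤ (u + v) * (h (s + u) + h (s + v)) := by
      ring_nf at h1 h2 ⊢; linarith
    exact le_of_mul_le_mul_left h3 h0

lemma conc_dich {h : ℝ → ℝ} (hh : ConcaveOn ℝ (Set.Ici 0) h) (hc : ContinuousOn h (Set.Ici 0))
    {ε : ℝ} (hε : 0 < ε) (h0 : h 0 ≤ h ε) :
    MonotoneOn h (Set.Ici 0) ∨ ∃ m, 0 < m ∧ ∀ y, 0 ≤ y → h y ≤ h m := by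
  by_cases hm : MonotoneOn h (Set.Ici 0)
  · exact Or.inl hm
  right
  unfold MonotoneOn at hm
  push Not at hm
  obtain ⟨a, ha, e, he, hae, hlt⟩ := hm
  simp only [Set.mem_Ici] at ha he
  have hae' : a < e := by
    rcases eq_or_lt_of_le hae with h1 | h1
    · subst h1; exact absurd hlt (lt_irrefl _)
    · exact h1
  obtain ⟨m, hm, hmax⟩ := isCompact_Icc.exists_isMaxOn (s := Set.Icc 0 e) ⟨0, by simp [he]⟩
    (hc.mono (fun y hy => hy.1))
  have hg : ∀ y, 0 ≤ y → h y ≤ h m := by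
    intro y hy
    rcases le_total y e with h1 | h1
    · exact hmax ⟨hy, h1⟩
    · exact (conc_after hh ha hae' h1 hlt.le).trans (hmax ⟨he, le_rfl⟩)
  rcases eq_or_lt_of_le hm.1 with h1 | h1
  · subst h1
    exact ⟨ε, hε, fun y hy => (hg y hy).trans h0⟩
  · exact ⟨m, h1, hg⟩

/-- coalition `T` is willing to rise jointly from common total `t` -/
def Valid {n : ℕ} (b : Fin n → ℝ → ℝ) (c : Fin n → ℝ) (t : ℝ) (T : Finset (Fin n)) : Prop :=
  ∀ i ∈ T, ∃ ε, 0 < ε ∧ b i t + c i * ε ≤ b i (t + (T.card : ℝ) * ε)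

lemma card_erase_real {n : ℕ} {A : Finset (Fin n)} {i : Fin n} (hi : i ∈ A) :
    ((A.erase i).card : ℝ) + 1 = A.card := by
  exact_mod_cast Finset.card_erase_add_one hi

lemma sum_min_le {n : ℕ} (A : Finset (Fin n)) (y : ℝ) (z : Fin n → ℝ) :
    ∑ j ∈ A, min y (z j) ≤ (A.card : ℝ) * y := by
  calc _ ≤ ∑ j ∈ A, y := Finset.sum_le_sum (fun j _ => min_le_left _ _)
    _ = _ := by simp

lemma sum_min_eq {n : ℕ} (A : Finset (Fin n)) (y : ℝ) (z : Fin n → ℝ)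
    (h : ∀ j ∈ A, y ≤ z j) :
    ∑ j ∈ A, min y (z j) = (A.card : ℝ) * y := by
  rw [Finset.sum_congr rfl (fun j hj => min_eq_left (h j hj))]
  simp

lemma sum_min_nonneg {n : ℕ} (A : Finset (Fin n)) {y : ℝ} (hy : 0 ≤ y) {z : Fin n → ℝ}
    (hz : ∀ j, 0 ≤ z j) : 0 ≤ ∑ j ∈ A, min y (z j) :=
  Finset.sum_nonneg (fun j _ => le_min hy (hz j))

lemma fill {n : ℕ} (b : Fin n → ℝ → ℝ) (c : Fin n → ℝ)
    (hc : ∀ i, 0 < c i)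
    (hbc : ∀ i, ContinuousOn (b i) (Set.Ici 0))
    (hbm : ∀ i, MonotoneOn (b i) (Set.Ici 0))
    (hbconc : ∀ i, ConcaveOn ℝ (Set.Ici 0) (b i))
    (R : ℝ) (hR : ∀ i, ∀ s, 0 ≤ s → R ≤ s → ∀ h, 0 ≤ h → b i (s + h) ≤ b i s + c i * h)
    (A : Finset (Fin n)) : ∀ t : ℝ, 0 ≤ t →
    ∃ z : Fin n → ℝ, (∀ i, 0 ≤ z i) ∧
      (∀ i ∈ A, ∀ y, 0 ≤ y → b i (t + (y + ∑ j ∈ A.erase i, min y (z j))) - c i * y ≤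
        b i (t + (z i + ∑ j ∈ A.erase i, min (z i) (z j))) - c i * z i) ∧
      (∀ T ⊆ A, Valid b c t T → ∀ i ∈ T, 0 < z i) := by
  classical
  induction A using Finset.strongInduction with
  | H A ih =>
  intro t ht
  by_cases hA : Valid b c t A
  · -- the whole group rises
    rcases A.eq_empty_or_nonempty with hE | hne
    · subst hE
      refine ⟨fun _ => 0, fun _ => le_rfl, by simp, ?_⟩
      intro T hT _ i hi
      exact absurd (hT hi) (by simp)
    set N : ℝ := (A.card : ℝ) with hN
    have hN1 : 1 ≤ N := by
      rw [hN]; exact_mod_cast hne.card_pos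
    set h : Fin n → ℝ → ℝ := fun i y => b i (t + N * y) - c i * y with hh
    have hmaps : ∀ y : ℝ, 0 ≤ y → 0 ≤ t + N * y := fun y hy => by positivity
    have hconc : ∀ i, ConcaveOn ℝ (Set.Ici 0) (h i) := by
      intro i
      refine ⟨convex_Ici 0, ?_⟩
      intro x hx y hy p q hp hq hpq
      have := (hbconc i).2 (x := t + N * x) (y := t + N * y) (hmaps x hx) (hmaps y hy) hp hq hpq
      simp only [smul_eq_mul, hh] at this ⊢
      have e : p * (t + N * x) + q * (t + N * y) = t + N * (p * x + q * y) := by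
        have : t = (p + q) * t := by rw [hpq, one_mul]
        linear_combination -this
      rw [e] at this
      linarith
    have hcont : ∀ i, ContinuousOn (h i) (Set.Ici 0) := by
      intro i
      apply ContinuousOn.sub
      · exact (hbc i).comp (by fun_prop) (fun y hy => hmaps y hy)
      · fun_prop
    have hd : ∀ i ∈ A, MonotoneOn (h i) (Set.Ici 0) ∨ ∃ m, 0 < m ∧ ∀ y, 0 ≤ y → h i y ≤ h i m := by
      intro i hi
      obtain ⟨ε, hε, hle⟩ := hA i hi
      refine conc_dich (hconc i) (hcont i) hε ?_
      simp only [hh, mul_zero, add_zero, sub_zero]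
      linarith
    by_cases hall : ∀ i ∈ A, MonotoneOn (h i) (Set.Ici 0)
    · set e : ℝ := max R 1
      have he : 0 < e := lt_of_lt_of_le one_pos (le_max_right _ _)
      have heR : R ≤ e := le_max_left _ _
      refine ⟨fun _ => e, fun _ => he.le, ?_, fun _ _ _ _ _ => he⟩
      intro i hi y hy
      have hce := card_erase_real hi
      have e0 : e + ∑ j ∈ A.erase i, min e e = N * e := by
        simp; rw [hN, ← hce]; ring
      show _ ≤ b i (t + (e + ∑ j ∈ A.erase i, min e e)) - c i * e
      rw [e0]
      rcases le_total y e with h1 | h1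
      · have e1 : y + ∑ j ∈ A.erase i, min y e = N * y := by
          simp [min_eq_left h1]; rw [hN, ← hce]; ring
        rw [e1]
        exact hall i hi hy he.le h1
      · have e1 : y + ∑ j ∈ A.erase i, min y e = N * e + (y - e) := by
          simp [min_eq_right h1]; rw [hN, ← hce]; ring
        rw [e1]
        have := hR i (t + N * e) (hmaps e he.le) (by nlinarith) (y - e) (by linarith)
        rw [← add_assoc]
        linarith
    · push Not at hall
      obtain ⟨i0, hi0, hi0n⟩ := hall
      have hm : ∀ i, ∃ m, i ∈ A → ¬ MonotoneOn (h i) (Set.Ici 0) →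
          0 < m ∧ ∀ y, 0 ≤ y → h i y ≤ h i m := by
        intro i
        by_cases hi : i ∈ A
        · rcases hd i hi with h1 | ⟨m, h1⟩
          · exact ⟨0, fun _ h2 => absurd h1 h2⟩
          · exact ⟨m, fun _ _ => h1⟩
        · exact ⟨0, fun h1 => absurd h1 hi⟩
      choose m hm using hm
      obtain ⟨k, hk, hkmin⟩ := (A.filter (fun i => ¬ MonotoneOn (h i) (Set.Ici 0))).exists_min_image
        m ⟨i0, by simp [hi0, hi0n]⟩
      obtain ⟨hkA, hkn⟩ := Finset.mem_filter.1 hk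
      set e := m k with he
      obtain ⟨hepos, hkmax⟩ := hm k hkA hkn
      replace hkmax : ∀ y, 0 ≤ y → h k y ≤ h k e := hkmax
      replace hepos : 0 < e := hepos
      have hmon : ∀ i ∈ A, ∀ y, 0 ≤ y → y ≤ e → h i y ≤ h i e := by
        intro i hi y hy hye
        by_cases h1 : MonotoneOn (h i) (Set.Ici 0)
        · exact h1 hy hepos.le hye
        · exact conc_mid (hconc i) hy hye (hkmin i (by simp [hi, h1])) ((hm i hi h1).2 y hy)
      obtain ⟨z, hz0, hz, -⟩ := ih (A.erase k) (Finset.erase_ssubset hkA) (t + N * e)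
        (hmaps e hepos.le)
      set w : Fin n → ℝ := fun i => if i = k then e else e + z i with hw
      have hwe : ∀ i, e ≤ w i := by
        intro i; simp only [hw]; split_ifs
        · exact le_rfl
        · linarith [hz0 i]
      have hlow : ∀ i ∈ A, ∀ y, y ≤ e → y + ∑ j ∈ A.erase i, min y (w j) = N * y := by
        intro i hi y hy
        rw [sum_min_eq _ _ _ (fun j _ => hy.trans (hwe j)), hN, ← card_erase_real hi]; ring
      have hup : ∀ i ∈ A, i ≠ k → ∀ y, 0 ≤ y →
          (e + y) + ∑ j ∈ A.erase i, min (e + y) (w j) =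
            N * e + (y + ∑ j ∈ (A.erase k).erase i, min y (z j)) := by
        intro i hi hik y hy
        have hkk : k ∈ A.erase i := by simp [hkA, Ne.symm hik]
        rw [← Finset.add_sum_erase _ _ hkk]
        have e1 : (A.erase i).erase k = (A.erase k).erase i := Finset.erase_right_comm
        have e2 : ∑ j ∈ (A.erase i).erase k, min (e + y) (w j)
            = ∑ j ∈ (A.erase i).erase k, (e + min y (z j)) := by
          apply Finset.sum_congr rfl
          intro j hj
          have : j ≠ k := (Finset.mem_erase.1 hj).1
          simp only [hw, this, if_false]
          rw [min_add_add_left]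
        have e3 : min (e + y) (w k) = e := by
          simp only [hw, if_true]; exact min_eq_right (by linarith)
        rw [e2, e3, Finset.sum_add_distrib, ← e1, hN, ← card_erase_real hi, ← card_erase_real hkk]
        simp only [Finset.sum_const, nsmul_eq_mul]
        ring
      refine ⟨w, fun i => hepos.le.trans (hwe i), ?_, fun _ _ _ i _ => hepos.trans_le (hwe i)⟩
      intro i hi y hy
      by_cases hik : i = k
      · have hwi : w i = e := by simp [hw, hik]
        rw [hwi, hlow i hi e le_rfl]
        have h1 : y + ∑ j ∈ A.erase i, min y (w j) ≤ N * y := by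
          have := sum_min_le (A.erase i) y w
          rw [hN, ← card_erase_real hi]; linarith
        have h2 : 0 ≤ y + ∑ j ∈ A.erase i, min y (w j) :=
          add_nonneg hy (sum_min_nonneg _ hy (fun j => hepos.le.trans (hwe j)))
        have h3 := hbm i (a := t + (y + ∑ j ∈ A.erase i, min y (w j))) (b := t + N * y)
          (add_nonneg ht h2) (hmaps y hy) (by linarith)
        have h4 := hkmax y hy
        have h4 : h i y ≤ h i e := by rw [hik]; exact h4
        simp only [hh] at h4
        linarith
      · have hwi : w i = e + z i := by simp [hw, hik]
        have hzi := hz i (by simp [hi, hik])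
        rw [hwi, hup i hi hik (z i) (hz0 i)]
        have key : ∀ y, 0 ≤ y → b i (t + (e + y + ∑ j ∈ A.erase i, min (e + y) (w j))) - c i * (e + y)
            ≤ b i (t + (N * e + (z i + ∑ j ∈ (A.erase k).erase i, min (z i) (z j)))) - c i * (e + z i) := by
          intro y hy
          have := hzi y hy
          rw [hup i hi hik y hy, ← add_assoc t, ← add_assoc t]
          linarith
        rcases le_total y e with h1 | h1
        · have h2 := key 0 le_rfl
          simp only [add_zero] at h2
          rw [hlow i hi e le_rfl] at h2
          rw [hlow i hi y h1]
          exact (hmon i hi y hy h1).trans h2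
        · have h2 := key (y - e) (by linarith)
          have e1 : e + (y - e) = y := by ring
          rw [e1] at h2
          exact h2
  · -- someone drops out
    set B : Finset (Fin n) := A.filter (fun i => ∃ T ⊆ A, Valid b c t T ∧ i ∈ T) with hB
    have hTB : ∀ T ⊆ A, Valid b c t T → T ⊆ B := by
      intro T hT hv i hi
      exact Finset.mem_filter.2 ⟨hT hi, T, hT, hv, hi⟩
    have hBv : Valid b c t B := by
      intro i hi
      obtain ⟨-, T, hT, hv, hiT⟩ := Finset.mem_filter.1 hi
      obtain ⟨ε, hε, hle⟩ := hv i hiT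
      refine ⟨ε, hε, hle.trans ?_⟩
      have hcard : (T.card : ℝ) ≤ B.card := by
        exact_mod_cast Finset.card_le_card (hTB T hT hv)
      apply hbm i
      · simp only [Set.mem_Ici]; positivity
      · simp only [Set.mem_Ici]; positivity
      · gcongr
    have hBA : B ⊂ A := by
      refine (Finset.filter_subset _ _).ssubset_of_ne ?_
      intro h; rw [← h] at hA; exact hA hBv
    obtain ⟨z, hz0, hz, hzp⟩ := ih B hBA t ht
    set w : Fin n → ℝ := fun i => if i ∈ B then z i else 0 with hw
    have hw0 : ∀ i, 0 ≤ w i := by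
      intro i; simp only [hw]; split_ifs
      · exact hz0 i
      · exact le_rfl
    have hsum : ∀ i, ∀ y, 0 ≤ y → ∑ j ∈ A.erase i, min y (w j) = ∑ j ∈ B.erase i, min y (z j) := by
      intro i y hy
      rw [← Finset.sum_subset (Finset.erase_subset_erase i hBA.1)]
      · apply Finset.sum_congr rfl
        intro j hj
        simp [hw, (Finset.mem_erase.1 hj).2]
      · intro j hj hj2
        have : j ∉ B := fun h => hj2 (Finset.mem_erase.2 ⟨(Finset.mem_erase.1 hj).1, h⟩)
        simp [hw, this, hy]
    refine ⟨w, hw0, ?_, ?_⟩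
    · intro i hi y hy
      rw [hsum i y hy, hsum i (w i) (hw0 i)]
      by_cases hiB : i ∈ B
      · have : w i = z i := by simp [hw, hiB]
        rw [this]
        exact hz i hiB y hy
      · have hwi : w i = 0 := by simp [hw, hiB]
        rw [hwi, Finset.erase_eq_of_notMem hiB]
        have e0 : ∑ j ∈ B, min 0 (z j) = 0 :=
          Finset.sum_eq_zero (fun j _ => min_eq_left (hz0 j))
        rw [e0]
        simp only [add_zero, mul_zero, sub_zero]
        by_contra hcon
        push Not at hcon
        have hypos : 0 < y := by
          rcases eq_or_lt_of_le hy with h1 | h1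
          · subst h1
            rw [e0] at hcon
            simp at hcon
          · exact h1
        have hins : insert i B ⊆ A := Finset.insert_subset hi hBA.1
        have hci : ((insert i B).card : ℝ) = B.card + 1 := by
          rw [Finset.card_insert_of_notMem hiB]; push_cast; ring
        apply hiB
        refine hTB (insert i B) hins ?_ (Finset.mem_insert_self _ _)
        intro j hj
        rcases Finset.mem_insert.1 hj with rfl | hjB
        · refine ⟨y, hypos, ?_⟩
          have h1 := sum_min_le B y z
          have h2 := sum_min_nonneg B hy hz0
          have h3 := hbm j (a := t + (y + ∑ j ∈ B, min y (z j))) (b := t + ((insert j B).card : ℝ) * y)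
            (by simp only [Set.mem_Ici]; positivity) (by simp only [Set.mem_Ici]; positivity)
            (by rw [hci]; linarith)
          linarith
        · obtain ⟨ε, hε, hle⟩ := hBv j hjB
          refine ⟨ε, hε, hle.trans ?_⟩
          apply hbm j
          · simp only [Set.mem_Ici]; positivity
          · simp only [Set.mem_Ici]; positivity
          · rw [hci]; linarith
    · intro T hT hv i hi
      have hiB := hTB T hT hv hi
      simp only [hw, hiB, if_true]
      exact hzp B le_rfl hBv i hiB

/-- total of agent `i` when it plays `y` against `X` -/
noncomputable def W {n : ℕ} (X : Fin n → ℝ) (i : Fin n) (y : ℝ) : ℝ :=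
  y + ∑ j ∈ univ.erase i, min y (X j)

lemma filter_ne_erase {n : ℕ} (i : Fin n) :
    univ.filter (fun j => j ≠ i) = univ.erase i := by
  ext j; simp

lemma total_eq {n : ℕ} (X : Fin n → ℝ) (i : Fin n) : total X i = W X i (X i) := by
  unfold total W; rw [filter_ne_erase]

lemma W_update {n : ℕ} (X : Fin n → ℝ) (i : Fin n) (y v : ℝ) :
    W (Function.update X i y) i v = W X i v := by
  unfold W
  congr 1
  apply Finset.sum_congr rfl
  intro j hj
  rw [Function.update_of_ne (Finset.mem_erase.1 hj).1]

lemma U_update {n : ℕ} (b : Fin n → ℝ → ℝ) (c : Fin n → ℝ) (X : Fin n → ℝ) (i : Fin n) (y : ℝ) :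
    U b c (Function.update X i y) i = b i (W X i y) - c i * y := by
  unfold U
  rw [total_eq, W_update, Function.update_self]

lemma U_eq {n : ℕ} (b : Fin n → ℝ → ℝ) (c : Fin n → ℝ) (X : Fin n → ℝ) (i : Fin n) :
    U b c X i = b i (W X i (X i)) - c i * X i := by
  unfold U; rw [total_eq]

lemma W_nonneg {n : ℕ} {X : Fin n → ℝ} (hX : ∀ i, 0 ≤ X i) (i : Fin n) {y : ℝ} (hy : 0 ≤ y) :
    0 ≤ W X i y := add_nonneg hy (sum_min_nonneg _ hy hX)

lemma W_eq_sum {n : ℕ} (X : Fin n → ℝ) (i : Fin n) : W X i (X i) = ∑ j, min (X i) (X j) := by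
  unfold W
  rw [← Finset.add_sum_erase _ _ (Finset.mem_univ i), min_self]

lemma F_conc {n : ℕ} {b : Fin n → ℝ → ℝ} (c : Fin n → ℝ)
    (hbm : ∀ i, MonotoneOn (b i) (Set.Ici 0))
    (hbconc : ∀ i, ConcaveOn ℝ (Set.Ici 0) (b i)) {X : Fin n → ℝ} (hX : ∀ i, 0 ≤ X i)
    (i : Fin n) : ConcaveOn ℝ (Set.Ici 0) (fun y => b i (W X i y) - c i * y) := by
  refine ⟨convex_Ici 0, ?_⟩
  intro x hx y hy p q hp hq hpq
  simp only [Set.mem_Ici] at hx hy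
  simp only [smul_eq_mul]
  have hWx := W_nonneg hX i hx
  have hWy := W_nonneg hX i hy
  have h1 := (hbconc i).2 (x := W X i x) (y := W X i y) hWx hWy hp hq hpq
  simp only [smul_eq_mul] at h1
  have h2 : p * W X i x + q * W X i y ≤ W X i (p * x + q * y) := by
    unfold W
    have : p * ∑ j ∈ univ.erase i, min x (X j) + q * ∑ j ∈ univ.erase i, min y (X j)
        ≤ ∑ j ∈ univ.erase i, min (p * x + q * y) (X j) := by
      rw [Finset.mul_sum, Finset.mul_sum, ← Finset.sum_add_distrib]
      apply Finset.sum_le_sum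
      intro j _
      apply le_min
      · have a1 := mul_le_mul_of_nonneg_left (min_le_left x (X j)) hp
        have a2 := mul_le_mul_of_nonneg_left (min_le_left y (X j)) hq
        linarith
      · have a1 := mul_le_mul_of_nonneg_left (min_le_right x (X j)) hp
        have a2 := mul_le_mul_of_nonneg_left (min_le_right y (X j)) hq
        have a3 : p * X j + q * X j = X j := by rw [← add_mul, hpq, one_mul]
        linarith
    linarith
  have h3 := hbm i (a := p * W X i x + q * W X i y) (b := W X i (p * x + q * y))
    (by simp only [Set.mem_Ici]; positivity)
    (W_nonneg hX i (by positivity)) h2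
  linarith

/-- Global Pareto optimality of the maximal equilibrium: no nonnegative collection profile
(equilibrium or not) Pareto-dominates it. -/
theorem maximal_equilibrium_globally_pareto_optimal (n : ℕ)
    (b : Fin n → ℝ → ℝ) (c : Fin n → ℝ)
    (hc : ∀ i, 0 < c i)
    (hbc : ∀ i, ContinuousOn (b i) (Set.Ici 0))
    (hbm : ∀ i, MonotoneOn (b i) (Set.Ici 0))
    (hbconc : ∀ i, ConcaveOn ℝ (Set.Ici 0) (b i))
    (Xstar : Fin n → ℝ) (hstar : IsNE b c Xstar)
    (hdom : ∀ X' : Fin n → ℝ, IsNE b c X' → ∀ i, total X' i ≤ total Xstar i) :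
    ¬ ∃ X' : Fin n → ℝ, (∀ i, 0 ≤ X' i) ∧
      (∀ i, U b c Xstar i ≤ U b c X' i) ∧ (∃ j, U b c Xstar j < U b c X' j) := by
  classical
  rintro ⟨Y, hY0, hYU, j0, hj0⟩
  obtain ⟨hX0, hXne⟩ := hstar
  set X := Xstar with hXdef
  have hne : ∀ i, ∀ y, 0 ≤ y → b i (W X i y) - c i * y ≤ b i (W X i (X i)) - c i * X i := by
    intro i y hy
    have := hXne i y hy
    rwa [U_update, U_eq] at this
  -- someone collects more
  set S : Finset (Fin n) := univ.filter (fun i => X i < Y i) with hS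
  have hSne : S.Nonempty := by
    by_contra hcon
    rw [Finset.not_nonempty_iff_eq_empty] at hcon
    have hle : ∀ i, Y i ≤ X i := by
      intro i
      by_contra h
      have : i ∈ S := by simp [hS]; linarith
      rw [hcon] at this; simp at this
    have h1 : W Y j0 (Y j0) ≤ W X j0 (Y j0) := by
      unfold W
      gcongr with j _
      exact hle j
    have h2 := hbm j0 (W_nonneg hY0 j0 (hY0 j0)) (W_nonneg hX0 j0 (hY0 j0)) h1
    have h3 := hne j0 (Y j0) (hY0 j0)
    rw [U_eq, U_eq] at hj0
    linarith
  obtain ⟨i0, hi0, himin⟩ := S.exists_min_image X hSne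
  have hi0' : X i0 < Y i0 := by simpa [hS] using hi0
  set x := X i0 with hx
  have hx0 : 0 ≤ x := hX0 i0
  set t : ℝ := ∑ j, min x (X j) with ht
  have ht0 : 0 ≤ t := sum_min_nonneg _ hx0 hX0
  set A : Finset (Fin n) := univ.filter (fun i => x ≤ X i) with hA
  have htW : ∀ i ∈ A, W X i x = t := by
    intro i hi
    have hi' : x ≤ X i := by simpa [hA] using hi
    rw [ht, ← Finset.add_sum_erase _ _ (Finset.mem_univ i), min_eq_left hi']
    rfl
  -- bounded slopes
  have hR : ∀ i, ∀ s, 0 ≤ s → (∑ k, W X k (X k)) ≤ s → ∀ h, 0 ≤ h → b i (s + h) ≤ b i s + c i * h := by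
    intro i s hs hRs h hh
    have hWi := W_nonneg hX0 i (hX0 i)
    have h1 : W X i (X i) ≤ s := by
      refine le_trans ?_ hRs
      exact Finset.single_le_sum (f := fun k => W X k (X k))
        (fun k _ => W_nonneg hX0 k (hX0 k)) (Finset.mem_univ i)
    have h2 : W X i (X i) + h ≤ W X i (X i + h) := by
      unfold W
      have : ∑ j ∈ univ.erase i, min (X i) (X j) ≤ ∑ j ∈ univ.erase i, min (X i + h) (X j) := by
        gcongr with j _
        linarith
      linarith
    have h3 := hne i (X i + h) (by linarith [hX0 i])
    have h4 := hbm i (a := W X i (X i) + h) (b := W X i (X i + h))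
      (by simp only [Set.mem_Ici]; positivity) (W_nonneg hX0 i (by linarith [hX0 i])) h2
    have h5 := conc_shift (hbconc i) (s := W X i (X i)) (u := s - W X i (X i)) (v := h) hWi
      (by linarith) hh
    have e1 : W X i (X i) + (s - W X i (X i)) = s := by ring
    rw [e1] at h5
    linarith
  obtain ⟨z, hz0, hz, hzp⟩ := fill b c hc hbc hbm hbconc _ hR A t ht0
  set V : Finset (Fin n) := A.filter (fun i => x < X i ∨ i ∈ S) with hV
  have hVA : V ⊆ A := Finset.filter_subset _ _
  have hsumV : ∀ (y : ℝ) (Z : Fin n → ℝ), (∀ k, k ∉ V → min y (Z k) ≤ min x (X k)) → 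
      ∑ k, min y (Z k) ≤ t + (V.card : ℝ) * (y - x) := by
    intro y Z hyZ
    have : ∑ k, min y (Z k) ≤ ∑ k, (min x (X k) + if k ∈ V then (y - x) else 0) := by
      apply Finset.sum_le_sum
      intro k _
      split_ifs with hk
      · have hk' : x ≤ X k := by simpa [hA] using hVA hk
        rw [min_eq_left hk']
        have := min_le_left y (Z k)
        linarith
      · have := hyZ k hk
        linarith
    refine this.trans (le_of_eq ?_)
    rw [Finset.sum_add_distrib]
    simp [ht]
    ring
  have hVnot : ∀ k, k ∉ V → X k ≤ x ∧ Y k ≤ X k := by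
    intro k hk
    have hkS : k ∉ S := by
      intro hkS
      apply hk
      have : x ≤ X k := himin k hkS
      simp [hV, hA, this, hkS]
    refine ⟨?_, ?_⟩
    · by_contra h
      push Not at h
      apply hk
      simp [hV, hA, h, h.le]
    · by_contra h
      push Not at h
      exact hkS (by simp [hS, h])
  have hVv : Valid b c t V := by
    intro i hi
    have hiA := hVA hi
    have hxi : x ≤ X i := by simpa [hA] using hiA
    by_cases hlt : x < X i
    · refine ⟨X i - x, by linarith, ?_⟩
      have h1 := hne i x hx0
      rw [htW i hiA] at h1
      have h2 : W X i (X i) ≤ t + (V.card : ℝ) * (X i - x) := by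
        rw [W_eq_sum]
        apply hsumV
        intro k hk
        have := (hVnot k hk).1
        rw [min_eq_right this]
        exact min_le_right _ _
      have h3 := hbm i (W_nonneg hX0 i (hX0 i))
        ((W_nonneg hX0 i (hX0 i)).trans h2 : (0:ℝ) ≤ _) h2
      linarith
    · have hxe : X i = x := by linarith
      have hiS : i ∈ S := by
        rcases (Finset.mem_filter.1 hi).2 with h | h
        · exact absurd h hlt
        · exact h
      have hXY : X i < Y i := by simpa [hS] using hiS
      refine ⟨Y i - x, by linarith, ?_⟩
      have h1 := hYU i
      rw [U_eq, U_eq] at h1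
      rw [hxe, htW i hiA] at h1
      have h2 : W Y i (Y i) ≤ t + (V.card : ℝ) * (Y i - x) := by
        rw [W_eq_sum]
        apply hsumV
        intro k hk
        have := hVnot k hk
        rw [min_eq_right this.1]
        exact (min_le_right _ _).trans this.2
      have h3 := hbm i (W_nonneg hY0 i (hY0 i))
        ((W_nonneg hY0 i (hY0 i)).trans h2 : (0:ℝ) ≤ _) h2
      linarith
  have hi0A : i0 ∈ A := by simp [hA, hx]
  have hi0V : i0 ∈ V := by
    rw [hV]; exact Finset.mem_filter.2 ⟨hi0A, Or.inr hi0⟩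
  have hzi0 : 0 < z i0 := hzp V hVA hVv i0 hi0V
  set Z : Fin n → ℝ := fun i => if x ≤ X i then x + z i else X i with hZ
  have hZA : ∀ i, x ≤ X i → Z i = x + z i := fun i h => by simp [hZ, h]
  have hZD : ∀ i, X i < x → Z i = X i := fun i h => by simp [hZ, not_le.2 h]
  have hZ0 : ∀ i, 0 ≤ Z i := by
    intro i
    rcases le_or_gt x (X i) with h | h
    · rw [hZA i h]; linarith [hz0 i]
    · rw [hZD i h]; exact hX0 i
  have hWlow : ∀ i, ∀ y, y ≤ x → W Z i y = W X i y := by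
    intro i y hy
    unfold W
    congr 1
    apply Finset.sum_congr rfl
    intro j _
    rcases le_or_gt x (X j) with h | h
    · rw [hZA j h, min_eq_left (by linarith [hz0 j]), min_eq_left (by linarith)]
    · rw [hZD j h]
  have hWup : ∀ i ∈ A, ∀ y, 0 ≤ y → W Z i (x + y) = t + (y + ∑ j ∈ A.erase i, min y (z j)) := by
    intro i hi y hy
    rw [← htW i hi]
    unfold W
    have : ∑ j ∈ univ.erase i, min (x + y) (Z j) = ∑ j ∈ univ.erase i, min x (X j)
        + ∑ j ∈ A.erase i, min y (z j) := by
      have e1 : A.erase i = (univ.erase i).filter (fun j => x ≤ X j) := by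
        ext j; simp [hA]
      rw [e1, Finset.sum_filter, ← Finset.sum_add_distrib]
      apply Finset.sum_congr rfl
      intro j _
      split_ifs with h
      · rw [hZA j h, min_add_add_left, min_eq_left h]
      · push Not at h
        rw [hZD j h, min_eq_right (by linarith), min_eq_right h.le, add_zero]
    rw [this]; ring
  have hZne : IsNE b c Z := by
    refine ⟨hZ0, ?_⟩
    intro i y hy
    rw [U_update, U_eq]
    have hFX := F_conc c hbm hbconc hX0 i
    have hFZ := F_conc c hbm hbconc hZ0 i
    rcases le_or_gt x (X i) with h | h
    · have hiA : i ∈ A := by simp [hA, h]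
      have key : ∀ y, 0 ≤ y → b i (W Z i (x + y)) - c i * (x + y)
          ≤ b i (W Z i (Z i)) - c i * Z i := by
        intro y hy
        rw [hZA i h, hWup i hiA y hy, hWup i hiA (z i) (hz0 i)]
        have := hz i hiA y hy
        linarith
      rcases le_total y x with h1 | h1
      · have h2 := key 0 le_rfl
        rw [add_zero, hWlow i x le_rfl] at h2
        rw [hWlow i y h1]
        exact (conc_mid hFX hy h1 h (hne i y hy)).trans h2
      · have h2 := key (y - x) (by linarith)
        rwa [add_sub_cancel] at h2
    · rw [hZD i h, hWlow i (X i) h.le]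
      rcases le_total y x with h1 | h1
      · rw [hWlow i y h1]; exact hne i y hy
      · have h2 := hne i x hx0
        have h3 := conc_after hFZ (hX0 i) h h1
          (by simp only [hWlow i x le_rfl, hWlow i (X i) h.le]; exact h2)
        simp only [hWlow i x le_rfl] at h3
        exact h3.trans h2
  have hfin := hdom Z hZne i0
  rw [total_eq, total_eq, hZA i0 le_rfl, hWup i0 hi0A (z i0) hzi0.le, htW i0 hi0A] at hfin
  have := sum_min_nonneg (A.erase i0) hzi0.le hz0
  linarith
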